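/- arXiv:2109.02144 — 2 statements merged into one kernel-verified Lean document; each statement's English description precedes it below -/
import Mathlib

section
/- Let B be a bicategory, D a category, and (⟨−⟩, θ) a shadow on B with values in D. Let (F, G, u, c) be an adjoint equivalence in B, i.e. an adjunction with 1-cells F : C → C′ and G : C′ → C, invertible unit u : U_C ⇒ G∘F, and invertible counit c : F∘G ⇒ U_{C′}, satisfying the triangle identities. Define the Euler characteristic χ(F) : ⟨U_C⟩ → ⟨U_{C′}⟩ as the composite ⟨U_C⟩ →^{⟨u⟩} ⟨G∘F⟩ →^{θ_{G,F}} ⟨F∘G⟩ →^{⟨c⟩} ⟨U_{C′}⟩, and χ(G) : ⟨U_{C′}⟩ → ⟨U_C⟩ as the composite ⟨U_{C′}⟩ →^{⟨c⁻¹⟩} ⟨F∘G⟩ →^{θ_{F,G}} ⟨G∘F⟩ →^{⟨u⁻¹⟩} ⟨U_C⟩. Then χ(F) is an isomorphism in D with inverse χ(G); that is, χ(G) ∘ χ(F) = id_{⟨U_C⟩} and χ(F) ∘ χ(G) = id_{⟨U_{C′}⟩}. -/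
/-!
STATEMENT 11: For a shadow `(⟨-⟩, θ)` on a bicategory `B` with values in a category `D`
and an adjoint equivalence `(F, G, u, c)` in `B`, the Euler characteristic
`χ(F) = ⟨c⟩ ∘ θ ∘ ⟨u⟩ : ⟨U_C⟩ → ⟨U_C'⟩` is an isomorphism with inverse
`χ(G) = ⟨u⁻¹⟩ ∘ θ ∘ ⟨c⁻¹⟩`.
-/

open CategoryTheory Bicategory

universe w v u v' u'

/-- A shadow on a bicategory `B` with values in a category `D` (Campbell–Ponto):
a functor `⟨-⟩ : ∐_X B(X,X) ⥤ D` (given as a family of functors on the endo-hom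
categories), together with natural isomorphisms `θ : ⟨F ≫ G⟩ ≅ ⟨G ≫ F⟩` satisfying
the cyclicity (hexagon) axiom with respect to the associators and the unit axiom
with respect to the unitors. -/
structure Shadow (B : Type u) [Bicategory.{w, v} B] (D : Type u') [Category.{v'} D] where
  /-- the underlying shadow functor, on each component `B(X,X)` of the disjoint union -/
  sh : ∀ X : B, (X ⟶ X) ⥤ D
  /-- the cyclicity isomorphism -/
  θ : ∀ {X Y : B} (F : X ⟶ Y) (G : Y ⟶ X), (sh X).obj (F ≫ G) ≅ (sh Y).obj (G ≫ F)
  /-- `θ` is natural in both variables -/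
  θ_natural :
    ∀ {X Y : B} {F F' : X ⟶ Y} {G G' : Y ⟶ X} (α : F ⟶ F') (β : G ⟶ G'),
      (sh X).map (α ▷ G ≫ F' ◁ β) ≫ (θ F' G').hom =
        (θ F G).hom ≫ (sh Y).map (β ▷ F ≫ G' ◁ α)
  /-- the cyclicity (hexagon) axiom relating `θ` and the associators -/
  θ_hexagon :
    ∀ {X Y Z : B} (F : X ⟶ Y) (G : Y ⟶ Z) (H : Z ⟶ X),
      (θ (F ≫ G) H).hom ≫ (sh Z).map (α_ H F G).inv =
        (sh X).map (α_ F G H).hom ≫ (θ F (G ≫ H)).hom ≫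
          (sh Y).map (α_ G H F).hom ≫ (θ G (H ≫ F)).hom
  /-- the unit axiom relating `θ` and the unitors -/
  θ_unit₁ :
    ∀ {X : B} (K : X ⟶ X),
      (θ (𝟙 X) K).hom ≫ (sh X).map (ρ_ K).hom = (sh X).map (λ_ K).hom
  /-- the other unit axiom relating `θ` and the unitors -/
  θ_unit₂ :
    ∀ {X : B} (K : X ⟶ X),
      (θ K (𝟙 X)).hom ≫ (sh X).map (λ_ K).hom = (sh X).map (ρ_ K).hom

/-- The Euler characteristic `χ(F) : ⟨U_C⟩ ⟶ ⟨U_C'⟩` of the left adjoint of an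
adjunction `(F, G, u, c)` in `B`, with respect to a shadow `S`:
the composite `⟨U_C⟩ → ⟨G∘F⟩ ≅ ⟨F∘G⟩ → ⟨U_C'⟩`. -/
def Shadow.euler {B : Type u} [Bicategory.{w, v} B] {D : Type u'} [Category.{v'} D]
    (S : Shadow B D) {C C' : B} {F : C ⟶ C'} {G : C' ⟶ C}
    (adj : Bicategory.Adjunction F G) :
    (S.sh C).obj (𝟙 C) ⟶ (S.sh C').obj (𝟙 C') :=
  (S.sh C).map adj.unit ≫ (S.θ F G).hom ≫ (S.sh C').map adj.counit

/-- The Euler characteristic `χ(G) : ⟨U_C'⟩ ⟶ ⟨U_C⟩` of the right adjoint of an adjoint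
equivalence `(F, G, u, c)` in `B` (`u`, `c` invertible), with respect to a shadow `S`:
the composite `⟨U_C'⟩ → ⟨F∘G⟩ ≅ ⟨G∘F⟩ → ⟨U_C⟩` built from `c⁻¹`, `θ` and `u⁻¹`. -/
noncomputable def Shadow.eulerInv {B : Type u} [Bicategory.{w, v} B] {D : Type u'} [Category.{v'} D]
    (S : Shadow B D) {C C' : B} {F : C ⟶ C'} {G : C' ⟶ C}
    (adj : Bicategory.Adjunction F G) [IsIso adj.unit] [IsIso adj.counit] :
    (S.sh C').obj (𝟙 C') ⟶ (S.sh C).obj (𝟙 C) :=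
  (S.sh C').map (inv adj.counit) ≫ (S.θ G F).hom ≫ (S.sh C).map (inv adj.unit)

namespace Shadow

variable {B : Type u} [Bicategory.{w, v} B] {D : Type u'} [Category.{v'} D] (S : Shadow B D)

theorem θ_natural_right {X Y : B} (F : X ⟶ Y) {G G' : Y ⟶ X} (β : G ⟶ G') :
    (S.sh X).map (F ◁ β) ≫ (S.θ F G').hom = (S.θ F G).hom ≫ (S.sh Y).map (β ▷ F) := by
  simpa using S.θ_natural (𝟙 F) β

/-- The cyclicity isomorphism of a shadow is an involution: this is the hexagon axiom
with an identity 1-cell in the third variable. -/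
theorem θ_hom_comp_θ_hom {X Y : B} (F : X ⟶ Y) (G : Y ⟶ X) :
    (S.θ F G).hom ≫ (S.θ G F).hom = 𝟙 _ := by
  have hexagon := S.θ_hexagon F G (𝟙 X)
  have unit : (S.θ (F ≫ G) (𝟙 X)).hom =
      (S.sh X).map (ρ_ (F ≫ G)).hom ≫ (S.sh X).map (λ_ (F ≫ G)).inv := by
    rw [← S.θ_unit₂, Category.assoc, ← Functor.map_comp, Iso.hom_inv_id,
      CategoryTheory.Functor.map_id, Category.comp_id]
  have natG : (S.θ F (G ≫ 𝟙 X)).hom =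
      (S.sh X).map (F ◁ (ρ_ G).hom) ≫ (S.θ F G).hom ≫ (S.sh Y).map ((ρ_ G).inv ▷ F) := by
    rw [← S.θ_natural_right, ← Functor.map_comp_assoc, ← whiskerLeft_comp, Iso.hom_inv_id,
      whiskerLeft_id, CategoryTheory.Functor.map_id, Category.id_comp]
  have triangle : (ρ_ G).inv ▷ F ≫ (α_ G (𝟙 X) F).hom = G ◁ (λ_ F).inv := by simp
  have natF := S.θ_natural_right G (λ_ F).inv
  have unitorF : (α_ F G (𝟙 X)).hom ≫ F ◁ (ρ_ G).hom = (ρ_ (F ≫ G)).hom := by simp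
  have unitorG : (λ_ (F ≫ G)).inv ≫ (α_ (𝟙 X) F G).inv = (λ_ F).inv ▷ G := by simp
  rw [unit, natG, Category.assoc, ← Functor.map_comp, unitorG] at hexagon
  simp only [Category.assoc] at hexagon
  rw [← Functor.map_comp_assoc, unitorF, ← Functor.map_comp_assoc, triangle, natF,
    cancel_epi] at hexagon
  rw [← cancel_mono ((S.sh X).map ((λ_ F).inv ▷ G)), Category.assoc, ← hexagon,
    Category.id_comp]

end Shadow

/-- If `(F, G, u, c)` is an adjoint equivalence in a bicategory `B`
equipped with a shadow `(⟨-⟩, θ)` valued in `D`, then the Euler characteristic `χ(F)`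
is an isomorphism in `D` with inverse `χ(G)`:
`χ(G) ∘ χ(F) = id` and `χ(F) ∘ χ(G) = id`. -/
theorem euler_char_isIso_of_adjoint_equivalence
    {B : Type u} [Bicategory.{w, v} B] {D : Type u'} [Category.{v'} D]
    (S : Shadow B D) {C C' : B} {F : C ⟶ C'} {G : C' ⟶ C}
    (adj : Bicategory.Adjunction F G) [IsIso adj.unit] [IsIso adj.counit] :
    S.euler adj ≫ S.eulerInv adj = 𝟙 ((S.sh C).obj (𝟙 C)) ∧
      S.eulerInv adj ≫ S.euler adj = 𝟙 ((S.sh C').obj (𝟙 C')) := by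
  constructor
  · simp only [Shadow.euler, Shadow.eulerInv, Category.assoc]
    rw [← Functor.map_comp_assoc, IsIso.hom_inv_id, CategoryTheory.Functor.map_id, Category.id_comp,
      ← Category.assoc (S.θ F G).hom, S.θ_hom_comp_θ_hom, Category.id_comp, ← Functor.map_comp,
      IsIso.hom_inv_id, CategoryTheory.Functor.map_id]
  · simp only [Shadow.euler, Shadow.eulerInv, Category.assoc]
    rw [← Functor.map_comp_assoc, IsIso.inv_hom_id, CategoryTheory.Functor.map_id, Category.id_comp,
      ← Category.assoc (S.θ G F).hom, S.θ_hom_comp_θ_hom, Category.id_comp, ← Functor.map_comp,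
      IsIso.inv_hom_id, CategoryTheory.Functor.map_id]
end

section
/- Let B be a bicategory, D a category, and (⟨−⟩, θ) a shadow on B with values in D. Let (F, G, u, c) be an adjoint equivalence in B with F : C → C′, G : C′ → C, invertible unit u : U_C ⇒ G∘F and invertible counit c : F∘G ⇒ U_{C′}, and let Q : C → C be any endo-1-cell. Then the trace tr(u_Q) : ⟨Q⟩ → ⟨F∘Q∘G⟩ — defined as the composite ⟨Q⟩ ≅ ⟨(G∘F∘Q) via u⟩ … explicitly: ⟨Q⟩ → ⟨G∘F∘Q⟩ (induced by u and the unitor), → ⟨G∘F∘Q∘G∘F⟩ (induced by inserting u on the right, via the unitor), ≅ ⟨F∘Q∘G∘F∘G⟩ (the cyclicity isomorphism θ_{G, F∘Q∘G∘F}), → ⟨F∘Q∘G⟩ (induced by c and the unitor) — is an isomorphism in D, with inverse the composite of the inverses of these four maps (the trace tr(c_Q) : ⟨F∘Q∘G⟩ → ⟨Q⟩ built from c⁻¹, θ⁻¹ and u⁻¹). -/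
/-!
STATEMENT 12: For a shadow `(⟨-⟩, θ)` on a bicategory `B` valued in a category `D`,
an adjoint equivalence `(F, G, u, c)` in `B` and an endo-1-cell `Q : C ⟶ C`,
the trace `tr(u_Q) : ⟨Q⟩ → ⟨F∘Q∘G⟩` is an isomorphism, with inverse the
composite `tr(c_Q)` of the inverses of its four constituent maps.
-/

open CategoryTheory Bicategory

universe w v u v' u'

variable {B : Type u} [Bicategory.{w, v} B] {D : Type u'} [Category.{v'} D]

/-- The trace `tr(u_Q) : ⟨Q⟩ ⟶ ⟨F∘Q∘G⟩` of an endomorphism `Q : C ⟶ C` with respect to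
an adjunction `(F, G, u, c)` and a shadow `S`: the composite
`⟨Q⟩ → ⟨G∘F∘Q⟩ → ⟨G∘F∘Q∘G∘F⟩ ≅ ⟨F∘Q∘G∘F∘G⟩ → ⟨F∘Q∘G⟩`
(the first two maps induced by the unit `u` and the unitors, the isomorphism being the
cyclicity isomorphism `θ`, and the last map induced by the counit `c` and the unitor;
associativity constraints are mediated by the canonical associators). -/
def Shadow.trace (S : Shadow B D) {C C' : B} {F : C ⟶ C'} {G : C' ⟶ C}
    (adj : Bicategory.Adjunction F G) (Q : C ⟶ C) :
    (S.sh C).obj Q ⟶ (S.sh C').obj (G ≫ Q ≫ F) :=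
  (S.sh C).map ((ρ_ Q).inv ≫ Q ◁ adj.unit) ≫
    (S.sh C).map ((λ_ (Q ≫ F ≫ G)).inv ≫ adj.unit ▷ (Q ≫ F ≫ G)) ≫
      (S.sh C).map ((F ≫ G) ◁ (α_ Q F G).inv ≫ (α_ (F ≫ G) (Q ≫ F) G).inv ≫
        (α_ F G (Q ≫ F)).hom ▷ G) ≫
        (S.θ (F ≫ G ≫ Q ≫ F) G).hom ≫
          (S.sh C').map ((α_ G F (G ≫ Q ≫ F)).inv ≫ adj.counit ▷ (G ≫ Q ≫ F) ≫
            (λ_ (G ≫ Q ≫ F)).hom)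

/-- The trace `tr(c_Q) : ⟨F∘Q∘G⟩ ⟶ ⟨Q⟩`, the composite of the inverses of the four maps
making up `tr(u_Q)`, built from `c⁻¹`, `θ⁻¹` and `u⁻¹`. -/
noncomputable def Shadow.traceInv (S : Shadow B D) {C C' : B} {F : C ⟶ C'} {G : C' ⟶ C}
    (adj : Bicategory.Adjunction F G) [IsIso adj.unit] [IsIso adj.counit] (Q : C ⟶ C) :
    (S.sh C').obj (G ≫ Q ≫ F) ⟶ (S.sh C).obj Q :=
  (S.sh C').map ((λ_ (G ≫ Q ≫ F)).inv ≫ inv adj.counit ▷ (G ≫ Q ≫ F) ≫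
      (α_ G F (G ≫ Q ≫ F)).hom) ≫
    (S.θ (F ≫ G ≫ Q ≫ F) G).inv ≫
      (S.sh C).map ((α_ F G (Q ≫ F)).inv ▷ G ≫ (α_ (F ≫ G) (Q ≫ F) G).hom ≫
        (F ≫ G) ◁ (α_ Q F G).hom) ≫
        (S.sh C).map (inv adj.unit ▷ (Q ≫ F ≫ G) ≫ (λ_ (Q ≫ F ≫ G)).hom) ≫
          (S.sh C).map (Q ◁ inv adj.unit ≫ (ρ_ Q).hom)

/-- The trace `tr(u_Q)` of an adjoint equivalence, assembled as an isomorphism from its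
invertible constituents. -/
noncomputable def Shadow.traceIso (S : Shadow B D) {C C' : B} {F : C ⟶ C'} {G : C' ⟶ C}
    (adj : Bicategory.Adjunction F G) [IsIso adj.unit] [IsIso adj.counit] (Q : C ⟶ C) :
    (S.sh C).obj Q ≅ (S.sh C').obj (G ≫ Q ≫ F) :=
  (S.sh C).mapIso ((ρ_ Q).symm ≪≫ whiskerLeftIso Q (asIso adj.unit)) ≪≫
    (S.sh C).mapIso ((λ_ (Q ≫ F ≫ G)).symm ≪≫
      whiskerRightIso (asIso adj.unit) (Q ≫ F ≫ G)) ≪≫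
      (S.sh C).mapIso (whiskerLeftIso (F ≫ G) (α_ Q F G).symm ≪≫
        (α_ (F ≫ G) (Q ≫ F) G).symm ≪≫ whiskerRightIso (α_ F G (Q ≫ F)) G) ≪≫
        S.θ (F ≫ G ≫ Q ≫ F) G ≪≫
          (S.sh C').mapIso ((α_ G F (G ≫ Q ≫ F)).symm ≪≫
            whiskerRightIso (asIso adj.counit) (G ≫ Q ≫ F) ≪≫ λ_ (G ≫ Q ≫ F))

theorem Shadow.traceIso_hom (S : Shadow B D) {C C' : B} {F : C ⟶ C'} {G : C' ⟶ C}
    (adj : Bicategory.Adjunction F G) [IsIso adj.unit] [IsIso adj.counit] (Q : C ⟶ C) :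
    (S.traceIso adj Q).hom = S.trace adj Q :=
  rfl

theorem Shadow.traceIso_inv (S : Shadow B D) {C C' : B} {F : C ⟶ C'} {G : C' ⟶ C}
    (adj : Bicategory.Adjunction F G) [IsIso adj.unit] [IsIso adj.counit] (Q : C ⟶ C) :
    (S.traceIso adj Q).inv = S.traceInv adj Q := by
  simp only [Shadow.traceIso, Shadow.traceInv, Iso.trans_inv, Functor.mapIso_inv, Iso.symm_inv,
    whiskerLeftIso_inv, whiskerRightIso_inv, asIso_inv, Category.assoc]

/-- For an adjoint equivalence `(F, G, u, c)` in `B` and any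
endo-1-cell `Q : C ⟶ C`, the trace `tr(u_Q) : ⟨Q⟩ → ⟨F∘Q∘G⟩` is an isomorphism in `D`,
with inverse `tr(c_Q)`. -/
theorem trace_isIso_of_adjoint_equivalence
    (S : Shadow B D) {C C' : B} {F : C ⟶ C'} {G : C' ⟶ C}
    (adj : Bicategory.Adjunction F G) [IsIso adj.unit] [IsIso adj.counit] (Q : C ⟶ C) :
    S.trace adj Q ≫ S.traceInv adj Q = 𝟙 ((S.sh C).obj Q) ∧
      S.traceInv adj Q ≫ S.trace adj Q = 𝟙 ((S.sh C').obj (G ≫ Q ≫ F)) := by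
  rw [← S.traceIso_hom, ← S.traceIso_inv]
  exact ⟨(S.traceIso adj Q).hom_inv_id, (S.traceIso adj Q).inv_hom_id⟩
end
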